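/- There is a universal constant C such that for every metric space (X,d) the following holds. Consider input sequences of labeled points of X, each point labeled either a source or a sink, with the first point s* always a sink and all points distinct. There exists an online algorithm producing, for each prefix s of the input, a finite set H(s) of unordered pairs of points (with H(s) ⊆ H(s') whenever s is a prefix of s'), and assigning to each arriving terminal v other than s* an integer class c(v) (determined by the prefix ending at v), such that for every input sequence s with set of sources R and set of sinks S: (a) d(H(s)) ≤ C·Σ_{v ∈ R} 2^{c(v)}; (b) for every prefix s' of s and every source u occurring in s', d_{H(s')}(u, S(s')) ≤ 3·d(u, S(s')), where S(s') is the set of sinks occurring in s' and d_G(u, Y) = min_{y∈Y} d_G(u,y); (c) for any two distinct terminals u,v ≠ s* with c(u) = c(v) = j, one has d(u,v) ≥ 2^j; (d) for every terminal u ≠ s*, d(u, {terminals arriving before u}) ≤ 2^{c(u)+1} and 2^{c(u)} ≤ d(u, s*). -/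

import Mathlib

open scoped Classical ENNReal

noncomputable section

variable {X : Type*} [MetricSpace X]

/-- The length of an unordered pair of points: the distance between its endpoints. -/
def edgeLen (e : Sym2 X) : ℝ :=
  Sym2.lift ⟨fun x y => dist x y, fun x y => dist_comm x y⟩ e

/-- The edges of a finite sequence of points: unordered pairs of consecutive points. -/
def edgeList (p : List X) : List (Sym2 X) :=
  (p.zip p.tail).map fun ab => s(ab.1, ab.2)

/-- The cost of a weighted graph (a finite set of unordered pairs of points):
the sum of the lengths of its edges. -/
def graphCost (H : Finset (Sym2 X)) : ℝ :=
  ∑ e ∈ H, edgeLen e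

/-- The total length of a finite sequence of points. -/
def pathLen (p : List X) : ℝ :=
  ((edgeList p).map edgeLen).sum

/-- `p` is a walk from `a` to `b` all of whose edges lie in `H`. -/
def IsWalkIn (H : Set (Sym2 X)) (a b : X) (p : List X) : Prop :=
  p.head? = some a ∧ p.getLast? = some b ∧ ∀ e ∈ edgeList p, e ∈ H

/-- The graph distance between `a` and `b` in the graph `H`: the infimum of the
lengths of walks from `a` to `b` using only edges of `H` (`∞` if there is none). -/
def graphDist (H : Set (Sym2 X)) (a b : X) : ℝ≥0∞ :=
  ⨅ p : { p : List X // IsWalkIn H a b p }, ENNReal.ofReal (pathLen p.1)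

/-- Graph distance from a point to a set of points. -/
def graphDistSet (H : Set (Sym2 X)) (a : X) (Y : Set X) : ℝ≥0∞ :=
  ⨅ y ∈ Y, graphDist H a y

/-- Metric distance from a point to a set of points (valued in `ℝ≥0∞`). -/
def eDistSet (a : X) (Y : Set X) : ℝ≥0∞ :=
  ⨅ y ∈ Y, ENNReal.ofReal (dist a y)

/-- The class of the last terminal `x` of a prefix: the largest `j` with `2 ^ j ≤ d(x, s*)` such
that every earlier terminal of class `j`, other than `s*`, is at distance at least `2 ^ j`. -/
def terminalClass (l : List (X × Bool)) : ℤ :=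
  sSup {j : ℤ | ∀ x ∈ l.getLast?, (∀ z ∈ l.head?, (2 : ℝ) ^ j ≤ dist x.1 z.1) ∧
    ∀ (i : ℕ) (_ : i + 1 < l.length), 1 ≤ i → terminalClass (l.take (i + 1)) = j →
      ∀ y ∈ l[i]?, (2 : ℝ) ^ j ≤ dist x.1 y.1}
termination_by l.length
decreasing_by simp only [List.length_take]; omega

/-- `e` joins the last terminal of `p` to an earlier nearby terminal of the next larger class. -/
def IsChainEdge (p : List (X × Bool)) (e : Sym2 X) : Prop :=
  ∃ x ∈ p.getLast?, ∃ i, 1 ≤ i ∧ i + 1 < p.length ∧ ∃ y ∈ p[i]?,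
    terminalClass (p.take (i + 1)) = terminalClass p + 1 ∧
    dist x.1 y.1 ≤ (2 : ℝ) ^ (terminalClass p + 1) ∧ e = s(x.1, y.1)

/-- One chosen chain edge of the last terminal of `p`, if there is any. -/
def chainEdges (p : List (X × Bool)) : Finset (Sym2 X) :=
  if h : ∃ e, IsChainEdge p e then {h.choose} else ∅

/-- The first sink of `l` within distance `2 ^ n` of `x`. -/
def firstSink (x : X) (n : ℤ) (l : List (X × Bool)) : Option (X × Bool) :=
  l.find? fun q => decide (q.2 = false ∧ dist x q.1 ≤ (2 : ℝ) ^ n)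

/-- The edges from `x` to the first sink within distance `2 ^ n`, for all scales `n ≤ k`. -/
def directEdges (k : ℤ) (x : X) (l : List (X × Bool)) : Finset (Sym2 X) :=
  (l.toFinset.filter fun q => ∃ n ≤ k, firstSink x n l = some q).image fun q => s(x, q.1)

/-- The edges bought for the terminal of `l` at position `i`. -/
def terminalEdges (l : List (X × Bool)) (i : Fin l.length) : Finset (Sym2 X) :=
  if (l.get i).2 = true then
    chainEdges (l.take (i + 1)) ∪
      directEdges (terminalClass (l.take (i + 1)) + 5) (l.get i).1 l
  else ∅

/-- All edges bought by the algorithm. -/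
def lastGraph (l : List (X × Bool)) : Finset (Sym2 X) :=
  Finset.univ.biUnion (terminalEdges l)

theorem firstSink_append {x : X} {n : ℤ} {l : List (X × Bool)} {q : X × Bool}
    (h : firstSink x n l = some q) (l' : List (X × Bool)) :
    firstSink x n (l ++ l') = some q := by
  unfold firstSink at *
  rw [List.find?_append, h, Option.some_or]

theorem of_firstSink_eq_some {x : X} {n : ℤ} {l : List (X × Bool)} {q : X × Bool}
    (h : firstSink x n l = some q) : q.2 = false ∧ dist x q.1 ≤ (2 : ℝ) ^ n := by
  have := List.find?_some h
  exact of_decide_eq_true this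

theorem directEdges_subset_append (k : ℤ) (x : X) (l l' : List (X × Bool)) :
    directEdges k x l ⊆ directEdges k x (l ++ l') := by
  refine Finset.image_subset_image fun q hq => ?_
  simp only [Finset.mem_filter, List.mem_toFinset, List.mem_append] at hq ⊢
  obtain ⟨hq, n, hn, h⟩ := hq
  exact ⟨Or.inl hq, n, hn, firstSink_append h l'⟩

theorem lastGraph_subset_append (l l' : List (X × Bool)) :
    lastGraph l ⊆ lastGraph (l ++ l') := by
  intro e he
  simp only [lastGraph, Finset.mem_biUnion, Finset.mem_univ, true_and] at he ⊢
  obtain ⟨i, hi⟩ := he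
  have hlt : (i : ℕ) < (l ++ l').length := by simp only [List.length_append]; omega
  refine ⟨⟨i, hlt⟩, ?_⟩
  have ht : (l ++ l').take (i + 1) = l.take (i + 1) := List.take_append_of_le_length (by omega)
  have hg : (l ++ l').get ⟨i, hlt⟩ = l.get i := by simp
  unfold terminalEdges at *
  rw [hg]
  simp only [ht]
  split_ifs at hi ⊢ with hs
  · exact Finset.union_subset_union_right (directEdges_subset_append _ _ l l') hi
  · exact hi

theorem sum_two_zpow_le (A : Finset ℤ) :
    ∀ k : ℤ, (∀ n ∈ A, n ≤ k) → ∑ n ∈ A, (2 : ℝ) ^ n ≤ (2 : ℝ) ^ (k + 1) := by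
  induction A using Finset.induction_on_max with
  | empty => intro k _; simp only [Finset.sum_empty]; positivity
  | insert m A hm ih =>
    intro k hk
    have hA := ih (m - 1) fun n hn => by have := hm n hn; omega
    rw [sub_add_cancel] at hA
    rw [Finset.sum_insert fun h => lt_irrefl _ (hm m h)]
    calc (2 : ℝ) ^ m + ∑ n ∈ A, (2 : ℝ) ^ n ≤ 2 ^ (m + 1) := by
          rw [zpow_add_one₀ two_ne_zero]; linarith
      _ ≤ 2 ^ (k + 1) :=
          zpow_le_zpow_right₀ one_le_two (by have := hk m (Finset.mem_insert_self _ _); omega)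

theorem edgeLen_nonneg (e : Sym2 X) : 0 ≤ edgeLen e := by
  induction e with
  | h x y => exact dist_nonneg

theorem graphCost_union_le (A B : Finset (Sym2 X)) :
    graphCost (A ∪ B) ≤ graphCost A + graphCost B := by
  unfold graphCost
  rw [← Finset.sum_union_inter]
  exact le_add_of_nonneg_right (Finset.sum_nonneg fun e _ => edgeLen_nonneg e)

theorem graphCost_biUnion_le {ι : Type*} (I : Finset ι) (f : ι → Finset (Sym2 X)) :
    graphCost (I.biUnion f) ≤ ∑ i ∈ I, graphCost (f i) := by
  induction I using Finset.induction_on with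
  | empty => simp [graphCost]
  | insert a I ha ih =>
    rw [Finset.biUnion_insert, Finset.sum_insert ha]
    exact (graphCost_union_le _ _).trans (by gcongr)

theorem graphCost_chainEdges_le (p : List (X × Bool)) :
    graphCost (chainEdges p) ≤ (2 : ℝ) ^ (terminalClass p + 1) := by
  unfold chainEdges
  split_ifs with h
  · obtain ⟨x, -, i, -, -, y, -, -, hd, he⟩ := h.choose_spec
    rw [graphCost, Finset.sum_singleton, he]
    exact hd
  · simp only [graphCost, Finset.sum_empty]
    positivity

theorem graphCost_directEdges_le (k : ℤ) (x : X) (l : List (X × Bool)) :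
    graphCost (directEdges k x l) ≤ (2 : ℝ) ^ (k + 1) := by
  set Q := l.toFinset.filter fun q => ∃ n ≤ k, firstSink x n l = some q
  have hex : ∀ q ∈ Q, ∃ n ≤ k, firstSink x n l = some q := fun q hq => (Finset.mem_filter.1 hq).2
  choose! f hfk hf using hex
  have hinj : Set.InjOn f Q := by
    intro q hq q' hq' h
    have := hf q hq
    rw [h, hf q' hq'] at this
    exact (Option.some.inj this).symm
  calc graphCost (directEdges k x l) ≤ ∑ q ∈ Q, edgeLen s(x, q.1) := by
        unfold graphCost directEdges
        exact Finset.sum_image_le_of_nonneg fun e _ => edgeLen_nonneg _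
    _ ≤ ∑ q ∈ Q, (2 : ℝ) ^ f q := by
        exact Finset.sum_le_sum fun q hq => (of_firstSink_eq_some (hf q hq)).2
    _ = ∑ n ∈ Q.image f, (2 : ℝ) ^ n := (Finset.sum_image hinj).symm
    _ ≤ (2 : ℝ) ^ (k + 1) := by
        refine sum_two_zpow_le _ k fun n hn => ?_
        obtain ⟨q, hq, rfl⟩ := Finset.mem_image.1 hn
        exact hfk q hq

theorem graphCost_lastGraph_le (l : List (X × Bool)) :
    graphCost (lastGraph l) ≤ 66 * ∑ i : Fin l.length,
      if (l.get i).2 = true then (2 : ℝ) ^ terminalClass (l.take (i + 1)) else 0 := by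
  rw [Finset.mul_sum]
  refine (graphCost_biUnion_le _ _).trans (Finset.sum_le_sum fun i _ => ?_)
  unfold terminalEdges
  split_ifs
  · have h1 := graphCost_chainEdges_le (l.take (i + 1))
    have h2 := graphCost_directEdges_le (terminalClass (l.take (i + 1)) + 5) (l.get i).1 l
    refine (graphCost_union_le _ _).trans ((add_le_add h1 h2).trans (le_of_eq ?_))
    simp only [zpow_add₀ (two_ne_zero' ℝ)]
    norm_num
    ring
  · simp [graphCost]

/-- Some walk of length at most `L` joins `a` to `b` in `H`. -/
def JoinedWithin (H : Set (Sym2 X)) (a b : X) (L : ℝ) : Prop :=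
  ∃ p, IsWalkIn H a b p ∧ pathLen p ≤ L

theorem edgeList_cons_cons {Y : Type*} (a b : Y) (p : List Y) :
    edgeList (a :: b :: p) = s(a, b) :: edgeList (b :: p) := rfl

theorem JoinedWithin.refl (H : Set (Sym2 X)) (a : X) : JoinedWithin H a a 0 :=
  ⟨[a], by simp [IsWalkIn, edgeList], by simp [pathLen, edgeList]⟩

theorem JoinedWithin.cons {H : Set (Sym2 X)} {a b c : X} {L : ℝ} (hab : s(a, b) ∈ H)
    (h : JoinedWithin H b c L) : JoinedWithin H a c (dist a b + L) := by
  obtain ⟨_ | ⟨b', p⟩, ⟨hh, hl, he⟩, hp⟩ := h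
  · simp at hh
  obtain rfl : b' = b := by simpa using hh
  refine ⟨a :: b' :: p, ⟨rfl, by simpa using hl, ?_⟩, ?_⟩
  · rw [edgeList_cons_cons]
    simpa [hab] using he
  · rw [pathLen, edgeList_cons_cons, List.map_cons, List.sum_cons]
    exact add_le_add le_rfl hp

theorem JoinedWithin.mono {H : Set (Sym2 X)} {a b : X} {L L' : ℝ} (h : JoinedWithin H a b L) (hL : L ≤ L') :
    JoinedWithin H a b L' :=
  let ⟨p, hp, hl⟩ := h
  ⟨p, hp, hl.trans hL⟩

theorem JoinedWithin.trans {H : Set (Sym2 X)} {a b c : X} {L L' : ℝ} (h : JoinedWithin H a b L)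
    (h' : JoinedWithin H b c L') : JoinedWithin H a c (L + L') := by
  obtain ⟨p, ⟨hh, hl, he⟩, hp⟩ := h
  induction p generalizing a L with
  | nil => simp at hh
  | cons a' p ih =>
    obtain rfl : a' = a := by simpa using hh
    cases p with
    | nil =>
      obtain rfl : a' = b := by simpa using hl
      have : (0 : ℝ) ≤ L := by simpa [pathLen, edgeList] using hp
      exact h'.mono (by linarith)
    | cons x p =>
      rw [edgeList_cons_cons] at he
      rw [pathLen, edgeList_cons_cons, List.map_cons, List.sum_cons] at hp
      have hp' : dist a' x + pathLen (x :: p) ≤ L := hp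
      have := ih (a := x) le_rfl rfl (by simpa using hl)
        fun e h => he e (List.mem_cons_of_mem _ h)
      exact (this.cons (he _ List.mem_cons_self)).mono (by linarith)

theorem JoinedWithin.of_edge {H : Set (Sym2 X)} {a b : X} (h : s(a, b) ∈ H) :
    JoinedWithin H a b (dist a b) := by
  simpa using (JoinedWithin.refl H b).cons h

theorem JoinedWithin.graphDistSet_le {H : Set (Sym2 X)} {a b : X} {L : ℝ} {Y : Set X}
    (h : JoinedWithin H a b L) (hb : b ∈ Y) : graphDistSet H a Y ≤ ENNReal.ofReal L := by
  obtain ⟨p, hp, hl⟩ := h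
  exact (iInf₂_le b hb).trans
    ((iInf_le _ (⟨p, hp⟩ : { p : List X // IsWalkIn H a b p })).trans (ENNReal.ofReal_le_ofReal hl))

theorem dist_pos_of_pairwise_ne {l : List (X × Bool)} (hl : (l.map Prod.fst).Pairwise Ne)
    {i j : ℕ} (hi : i < l.length) (hj : j < l.length) (hij : i ≠ j) :
    0 < dist l[i].1 l[j].1 := by
  refine dist_pos.2 fun h => hij ?_
  have := (List.Nodup.getElem_inj_iff (l := l.map Prod.fst) hl (i := i) (j := j)
    (hi := by simpa using hi) (hj := by simpa using hj)).1
  exact this (by simpa using h)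

/-- The integers that the terminal at position `i` may take as its class. -/
def AdmissibleClass (l : List (X × Bool)) (i : ℕ) (hi : i < l.length) (j : ℤ) : Prop :=
  (2 : ℝ) ^ j ≤ dist l[i].1 l[0].1 ∧
    ∀ (i' : ℕ) (h : i' < i), 1 ≤ i' → terminalClass (l.take (i' + 1)) = j →
      (2 : ℝ) ^ j ≤ dist l[i].1 l[i'].1

theorem terminalClass_take (l : List (X × Bool)) (i : ℕ) (hi : i < l.length) :
    terminalClass (l.take (i + 1)) = sSup {j | AdmissibleClass l i hi j} := by
  rw [terminalClass]
  congr 1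
  ext j
  have hlast : (l.take (i + 1)).getLast? = some l[i] := by
    rw [List.getLast?_take]; simp [hi]
  have hhead : (l.take (i + 1)).head? = some l[0] := by
    rw [List.head?_take]; simp [List.head?_eq_getElem?]
  have hlen : (l.take (i + 1)).length = i + 1 := by simp; omega
  simp only [Set.mem_ofPred_eq, hlast, hhead, hlen, Option.mem_some_iff, forall_eq',
    AdmissibleClass, Nat.add_lt_add_iff_right]
  refine and_congr_right fun _ => forall_congr' fun i' => forall_congr' fun h => ?_
  have hget : (l.take (i + 1))[i']? = some l[i'] := by
    rw [List.getElem?_take_of_lt (by omega)]; simp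
  have htake : (l.take (i + 1)).take (i' + 1) = l.take (i' + 1) := by
    rw [List.take_take, min_eq_left (by omega)]
  simp only [hget, htake, Option.mem_some_iff, forall_eq']

theorem exists_admissibleClass {l : List (X × Bool)} (hl : (l.map Prod.fst).Pairwise Ne)
    {i : ℕ} (hi : i < l.length) (h1 : 1 ≤ i) :
    ∃ j, AdmissibleClass l i hi j ∧ ∃ (i' : ℕ) (h : i' < i),
      dist l[i].1 l[i'].1 ≤ (2 : ℝ) ^ (j + 1) := by
  obtain ⟨m, -, hm⟩ := Finset.exists_min_image (Finset.univ : Finset (Fin i))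
    (fun k => dist l[i].1 l[k].1) ⟨⟨0, h1⟩, Finset.mem_univ _⟩
  obtain ⟨j, hj, hj'⟩ := exists_mem_Ico_zpow
    (dist_pos_of_pairwise_ne hl hi (m.2.trans hi) m.2.ne') one_lt_two
  have hle : ∀ (k : ℕ) (h : k < i), (2 : ℝ) ^ j ≤ dist l[i].1 l[k].1 := fun k h =>
    hj.trans (hm ⟨k, h⟩ (Finset.mem_univ _))
  exact ⟨j, ⟨hle 0 h1, fun k h _ _ => hle k h⟩, m, m.2, hj'.le⟩

theorem isGreatest_terminalClass {l : List (X × Bool)} (hl : (l.map Prod.fst).Pairwise Ne)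
    {i : ℕ} (hi : i < l.length) (h1 : 1 ≤ i) :
    IsGreatest {j | AdmissibleClass l i hi j} (terminalClass (l.take (i + 1))) := by
  obtain ⟨j, hj, -⟩ := exists_admissibleClass hl hi h1
  have hbdd : BddAbove {j | AdmissibleClass l i hi j} := by
    obtain ⟨N, -, hN⟩ := exists_mem_Ico_zpow
      (dist_pos_of_pairwise_ne hl hi (by omega : 0 < l.length) (by omega)) (one_lt_two (α := ℝ))
    refine ⟨N + 1, fun k hk => ?_⟩
    exact ((zpow_lt_zpow_iff_right₀ one_lt_two).1 (hk.1.trans_lt hN)).le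
  rw [terminalClass_take l i hi]
  exact ⟨Int.csSup_mem ⟨j, hj⟩ hbdd, fun k hk => le_csSup hbdd hk⟩

theorem two_zpow_terminalClass_le_dist {l : List (X × Bool)}
    (hl : (l.map Prod.fst).Pairwise Ne) {i j : ℕ} (hj : j < l.length) (hij : i < j) (h1 : 1 ≤ i)
    (h : terminalClass (l.take (i + 1)) = terminalClass (l.take (j + 1))) :
    (2 : ℝ) ^ terminalClass (l.take (j + 1)) ≤ dist l[j].1 l[i].1 :=
  (isGreatest_terminalClass hl hj (by omega)).1.2 i hij h1 h

theorem exists_dist_le_two_zpow {l : List (X × Bool)} (hl : (l.map Prod.fst).Pairwise Ne)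
    {i : ℕ} (hi : i < l.length) (h1 : 1 ≤ i) :
    ∃ (i' : ℕ) (h : i' < i),
      dist l[i].1 l[i'].1 ≤ (2 : ℝ) ^ (terminalClass (l.take (i + 1)) + 1) := by
  obtain ⟨j, hj, i', h, hd⟩ := exists_admissibleClass hl hi h1
  have := (isGreatest_terminalClass hl hi h1).2 hj
  exact ⟨i', h, hd.trans (zpow_le_zpow_right₀ one_le_two (by omega))⟩

theorem terminalEdges_subset_lastGraph (l : List (X × Bool)) (i : Fin l.length) :
    terminalEdges l i ⊆ lastGraph l :=
  Finset.subset_biUnion_of_mem _ (Finset.mem_univ i)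

theorem exists_joined_sink {l : List (X × Bool)} {i : ℕ} (hi : i < l.length)
    (hs : l[i].2 = true) {y : X} (hy : (y, false) ∈ l) (hpos : 0 < dist l[i].1 y)
    (hd : dist l[i].1 y ≤ 32 * (2 : ℝ) ^ terminalClass (l.take (i + 1))) :
    ∃ z, (z, false) ∈ l ∧ JoinedWithin (lastGraph l) l[i].1 z (2 * dist l[i].1 y) := by
  set c := terminalClass (l.take (i + 1))
  obtain ⟨n, hn, hn'⟩ := exists_mem_Ioc_zpow hpos (one_lt_two (α := ℝ))
  have hnc : n < c + 5 := by
    refine (zpow_lt_zpow_iff_right₀ (one_lt_two (α := ℝ))).1 (hn.trans_le (hd.trans_eq ?_))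
    rw [zpow_add₀ two_ne_zero]; norm_num; ring
  obtain ⟨q, hq⟩ : ∃ q, firstSink l[i].1 (n + 1) l = some q := by
    rw [← Option.isSome_iff_exists, firstSink, List.find?_isSome]
    exact ⟨_, hy, by simpa using hn'⟩
  have hmem : q ∈ l := List.mem_of_find?_eq_some hq
  obtain ⟨hq2, hqd⟩ := of_firstSink_eq_some hq
  refine ⟨q.1, by rw [← hq2]; exact hmem, (JoinedWithin.of_edge ?_).mono (hqd.trans ?_)⟩
  · refine terminalEdges_subset_lastGraph l ⟨i, hi⟩ ?_
    rw [terminalEdges, if_pos (by exact hs)]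
    refine Finset.mem_union_right _ (Finset.mem_image.2 ⟨q, ?_, rfl⟩)
    exact Finset.mem_filter.2 ⟨List.mem_toFinset.2 hmem, n + 1, hnc, hq⟩
  · rw [zpow_add_one₀ two_ne_zero]; linarith

theorem exists_joined_next_class {l : List (X × Bool)} (hl : (l.map Prod.fst).Pairwise Ne)
    {i : ℕ} (hi : i < l.length) (h1 : 1 ≤ i) (hs : l[i].2 = true)
    (hd : (2 : ℝ) ^ (terminalClass (l.take (i + 1)) + 1) ≤ dist l[i].1 l[0].1) :
    ∃ (i' : ℕ) (h : i' < l.length), 1 ≤ i' ∧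
      terminalClass (l.take (i' + 1)) = terminalClass (l.take (i + 1)) + 1 ∧
      dist l[i].1 l[i'].1 ≤ (2 : ℝ) ^ (terminalClass (l.take (i + 1)) + 1) ∧
      JoinedWithin (lastGraph l) l[i].1 l[i'].1 (dist l[i].1 l[i'].1) := by
  have hlast : (l.take (i + 1)).getLast? = some l[i] := by
    rw [List.getLast?_take]; simp [hi]
  have hlen : (l.take (i + 1)).length = i + 1 := by simp; omega
  have hget : ∀ (k : ℕ) (h : k < i), (l.take (i + 1))[k]? = some l[k] := fun k h => by
    rw [List.getElem?_take_of_lt (by omega)]; simp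
  have htake : ∀ k < i, (l.take (i + 1)).take (k + 1) = l.take (k + 1) := fun k h => by
    rw [List.take_take, min_eq_left (by omega)]
  have hex : ∃ e, IsChainEdge (l.take (i + 1)) e := by
    by_contra hne
    have hadm : AdmissibleClass l i hi (terminalClass (l.take (i + 1)) + 1) := by
      refine ⟨hd, fun k hk hk1 hkc => ?_⟩
      by_contra hlt
      exact hne ⟨_, l[i], hlast, k, hk1, by omega, l[k], hget k hk,
        by rw [htake k hk, hkc], (not_le.1 hlt).le, rfl⟩
    have := (isGreatest_terminalClass hl hi h1).2 hadm
    omega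
  obtain ⟨x, hx, k, hk1, hk, y, hy, hc, hxy, he⟩ := hex.choose_spec
  have hki : k < i := by omega
  obtain rfl : l[i] = x := by simpa [hlast] using hx
  obtain rfl : l[k] = y := by simpa [hget k hki] using hy
  rw [htake k hki] at hc
  refine ⟨k, by omega, hk1, hc, hxy, JoinedWithin.of_edge ?_⟩
  refine terminalEdges_subset_lastGraph l ⟨i, hi⟩ ?_
  rw [terminalEdges, if_pos (by exact hs)]
  refine Finset.mem_union_left _ ?_
  rw [chainEdges, dif_pos hex, Finset.mem_singleton, he]

theorem exists_joined_of_class_le {l : List (X × Bool)} (hl : (l.map Prod.fst).Pairwise Ne)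
    {i : ℕ} (hi : i < l.length) (h1 : 1 ≤ i) (hs : l[i].2 = true)
    (h0 : l[0].2 = false) {D : ℝ} (hD : ∀ y, (y, false) ∈ l → D ≤ dist l[i].1 y)
    (k : ℤ) (hk : terminalClass (l.take (i + 1)) ≤ k) (hkD : 8 * (2 : ℝ) ^ k ≤ D) :
    ∃ (i' : ℕ) (h : i' < l.length), l[i'].2 = true ∧ 1 ≤ i' ∧
      terminalClass (l.take (i' + 1)) = k ∧ dist l[i].1 l[i'].1 ≤ (2 : ℝ) ^ (k + 1) ∧
      JoinedWithin (lastGraph l) l[i].1 l[i'].1 ((2 : ℝ) ^ (k + 1)) := by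
  have hsink : ∀ (j : ℕ) (h : j < l.length), l[j].2 = false → D ≤ dist l[i].1 l[j].1 :=
    fun j h hj => hD _ (by rw [← hj]; exact List.getElem_mem h)
  induction k, hk using Int.leInduction with
  | base =>
    refine ⟨i, hi, hs, h1, rfl, ?_, (JoinedWithin.refl _ _).mono (by positivity)⟩
    rw [dist_self]; positivity
  | succ k hk ih =>
    have hpos : (0 : ℝ) < 2 ^ k := by positivity
    simp only [zpow_add_one₀ (two_ne_zero' ℝ)] at hkD ih ⊢
    obtain ⟨w, hw, hws, hw1, hwc, hwd, hwj⟩ := ih (by linarith)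
    have h0D := hsink 0 (by omega) h0
    obtain ⟨v, hv, hv1, hvc, hvd, hvj⟩ := exists_joined_next_class hl hw hw1 hws (by
      rw [hwc, zpow_add_one₀ two_ne_zero]
      linarith [dist_triangle l[i].1 l[w].1 l[0].1])
    rw [hwc, zpow_add_one₀ two_ne_zero] at hvd
    have hiv := dist_triangle l[i].1 l[w].1 l[v].1
    refine ⟨v, hv, ?_, hv1, by rw [hvc, hwc], by linarith, (hwj.trans hvj).mono (by linarith)⟩
    by_contra hvs
    have := hsink v hv (by simpa using hvs)
    linarith

theorem graphDistSet_lastGraph_le {l : List (X × Bool)} (hl : (l.map Prod.fst).Pairwise Ne)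
    {x0 : X} (h0 : l.head? = some (x0, false)) {i : ℕ} (hi : i < l.length)
    (hs : l[i].2 = true) :
    graphDistSet (lastGraph l) l[i].1 {x | (x, false) ∈ l} ≤
      3 * eDistSet l[i].1 {x | (x, false) ∈ l} := by
  have hl0 : l[0] = (x0, false) := by
    rw [List.head?_eq_getElem?, List.getElem?_eq_some_iff] at h0
    exact h0.2
  have h1 : 1 ≤ i := by
    rcases Nat.eq_zero_or_pos i with rfl | h
    · simp [hl0] at hs
    · exact h
  have hpos : ∀ (j : ℕ) (hj : j < l.length), l[j].2 = true → ∀ y, (y, false) ∈ l →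
      0 < dist l[j].1 y := by
    intro j hj hjs y hy
    obtain ⟨k, hk, hky⟩ := List.getElem_of_mem hy
    have hne : j ≠ k := by
      rintro rfl
      simp [hky] at hjs
    simpa [hky] using dist_pos_of_pairwise_ne hl hj hk hne
  obtain ⟨⟨y, b⟩, hy, hmin⟩ := Finset.exists_min_image (l.toFinset.filter fun q => q.2 = false)
    (fun q => dist l[i].1 q.1) ⟨l[0], by simp [hl0 ▸ List.getElem_mem (by omega : 0 < l.length), hl0]⟩
  simp only [Finset.mem_filter, List.mem_toFinset] at hy hmin
  obtain ⟨hy, rfl⟩ := hy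
  have hD : ∀ z, (z, false) ∈ l → dist l[i].1 y ≤ dist l[i].1 z := fun z hz =>
    hmin (z, false) ⟨hz, rfl⟩
  set D := dist l[i].1 y
  have hDpos : 0 < D := hpos i hi hs y hy
  suffices h : ∃ z, (z, false) ∈ l ∧ JoinedWithin (lastGraph l) l[i].1 z (3 * D) by
    obtain ⟨z, hz, hj⟩ := h
    refine (hj.graphDistSet_le (Y := {x | (x, false) ∈ l}) hz).trans ?_
    rw [ENNReal.ofReal_mul (by norm_num), ENNReal.ofReal_ofNat]
    gcongr
    exact le_iInf₂ fun z hz => ENNReal.ofReal_le_ofReal (hD z hz)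
  rcases le_or_gt D (32 * (2 : ℝ) ^ terminalClass (l.take (i + 1))) with hc | hc
  · obtain ⟨z, hz, hj⟩ := exists_joined_sink hi hs hy hDpos hc
    exact ⟨z, hz, hj.mono (by linarith)⟩
  · obtain ⟨k, hk, hk'⟩ := exists_mem_Ico_zpow (by positivity : 0 < D / 8) (one_lt_two (α := ℝ))
    have hkpos : (0 : ℝ) < 2 ^ k := by positivity
    have hck : terminalClass (l.take (i + 1)) < k + 1 := by
      refine (zpow_lt_zpow_iff_right₀ (one_lt_two (α := ℝ))).1 (lt_trans ?_ hk')
      have : (0 : ℝ) < 2 ^ terminalClass (l.take (i + 1)) := by positivity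
      linarith
    rw [zpow_add_one₀ two_ne_zero] at hk'
    obtain ⟨w, hw, hws, -, hwc, hwd, hwj⟩ := exists_joined_of_class_le hl hi h1 hs
      (by rw [hl0]) hD k (by omega) (by linarith)
    rw [zpow_add_one₀ two_ne_zero] at hwd hwj
    have hwy := dist_triangle_left l[w].1 y l[i].1
    obtain ⟨z, hz, hj⟩ := exists_joined_sink hw hws hy (hpos w hw hws y hy)
      (by rw [hwc]; linarith)
    exact ⟨z, hz, (hwj.trans hj).mono (by linarith)⟩

/-- **Lemma 9 (Multi-sink LAST).**
Terminals arrive online, each labeled a source (`true`) or a sink (`false`); the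
first terminal `x0 = s*` is a sink and all terminals are distinct. There are a
universal constant `C` and an online algorithm, maintaining a growing edge set
`H` and assigning to each arriving terminal an integer class (a function `cls` of
the prefix ending at that terminal), such that:
(a) the cost of `H` is at most `C · ∑_{v ∈ sources} 2^{class(v)}`;
(b) at every prefix, every source `u` seen so far satisfies
    `d_H(u, sinks) ≤ 3 · d(u, sinks)`;
(c) distinct terminals other than `s*` of equal class `j` are at distance ≥ `2^j`;
(d) every terminal `u ≠ s*` has some earlier terminal within distance
    `2^{class(u)+1}`, and `2^{class(u)} ≤ d(u, s*)`. -/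
theorem multi_sink_LAST :
    ∃ C : ℝ, 0 < C ∧
      ∀ (X : Type) [MetricSpace X],
        ∃ (H : List (X × Bool) → Finset (Sym2 X)) (cls : List (X × Bool) → ℤ),
          -- online: the edge set only grows
          (∀ l l' : List (X × Bool), H l ⊆ H (l ++ l')) ∧
          ∀ (s : List (X × Bool)) (x0 : X),
            s.head? = some (x0, false) →        -- the first terminal is a sink s* = x0
            (s.map Prod.fst).Pairwise Ne →      -- all terminals are distinct
            -- (a) cost bounded by the classes of the sources
            (graphCost (H s)
              ≤ C * ∑ j : Fin s.length,
                  if (s.get j).2 = true then (2 : ℝ) ^ (cls (s.take (↑j + 1))) else 0) ∧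
            -- (b) 3-stretch from each source to the sinks, at every prefix
            (∀ m ≤ s.length, ∀ j : Fin s.length, ↑j < m → (s.get j).2 = true →
              graphDistSet (↑(H (s.take m))) (s.get j).1 {x | (x, false) ∈ s.take m}
                ≤ 3 * eDistSet (s.get j).1 {x | (x, false) ∈ s.take m}) ∧
            -- (c) terminals (other than s*) of equal class j are 2^j-separated
            (∀ j1 j2 : Fin s.length, 1 ≤ (↑j1 : ℕ) → 1 ≤ (↑j2 : ℕ) → j1 ≠ j2 →
              cls (s.take (↑j1 + 1)) = cls (s.take (↑j2 + 1)) →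
              (2 : ℝ) ^ (cls (s.take (↑j1 + 1))) ≤ dist (s.get j1).1 (s.get j2).1) ∧
            -- (d) distance to earlier terminals and to s*
            (∀ j : Fin s.length, 1 ≤ (↑j : ℕ) →
              (∃ j' : Fin s.length, (↑j' : ℕ) < ↑j ∧
                dist (s.get j).1 (s.get j').1 ≤ (2 : ℝ) ^ (cls (s.take (↑j + 1)) + 1)) ∧
              (2 : ℝ) ^ (cls (s.take (↑j + 1))) ≤ dist (s.get j).1 x0) := by
  refine ⟨66, by norm_num, fun X _ => ⟨lastGraph, terminalClass, lastGraph_subset_append, ?_⟩⟩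
  intro s x0 h0 hs
  refine ⟨graphCost_lastGraph_le s, ?_, ?_, ?_⟩
  · intro m hm j hjm hj
    have hlt : (j : ℕ) < (s.take m).length := by simp only [List.length_take]; omega
    have hget : (s.take m)[(j : ℕ)] = s.get j := by simp
    have hhead : (s.take m).head? = some (x0, false) := by
      rw [List.head?_take, if_neg (by omega), h0]
    have hne : ((s.take m).map Prod.fst).Pairwise Ne :=
      hs.sublist ((List.take_sublist m s).map _)
    have := graphDistSet_lastGraph_le hne hhead hlt (by rw [hget, hj])
    rwa [hget] at this
  · intro j1 j2 h1 h2 hne hc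
    rcases lt_or_gt_of_ne (Fin.val_ne_of_ne hne) with h | h
    · rw [dist_comm, hc]
      exact two_zpow_terminalClass_le_dist hs j2.2 h h1 hc
    · exact two_zpow_terminalClass_le_dist hs j1.2 h h2 hc.symm
  · intro j h1
    obtain ⟨i, hi, hd⟩ := exists_dist_le_two_zpow hs j.2 h1
    refine ⟨⟨⟨i, hi.trans j.2⟩, hi, hd⟩, ?_⟩
    have hs0 : s[0] = (x0, false) := by
      rw [List.head?_eq_getElem?, List.getElem?_eq_some_iff] at h0
      exact h0.2
    have := (isGreatest_terminalClass hs j.2 h1).1.1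
    rwa [hs0] at this
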